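/- arXiv:math/0506042 — 2 statements merged into one kernel-verified Lean document; each statement's English description precedes it below -/
import Mathlib

section
/- Let h be an orientation-preserving homeomorphism of the plane fixing only 0 with Poincaré–Lefschetz index of the fixed point different from 1. Then every closed curve of degree 1 around 0 admits a decomposition into finitely many h-free subarcs, and there exists a Jordan curve of degree 1 around 0 realizing the minimal h-length (a geodesic Jordan curve). In particular the minimum of h-lengths over closed curves of degree 1 is attained by a simple closed curve. -/
open Set

/-- A curve `γ` (defined on `[0,1]`) with values in `ℂ ∖ {0}` has degree `n` around `0`
if it lifts through the covering `exp : ℂ → ℂ ∖ {0}` to a path whose endpoints differ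
by `2πin`. -/
def HasDeg (γ : ℝ → ℂ) (n : ℤ) : Prop :=
  ∃ g : ℝ → ℂ, ContinuousOn g (Icc 0 1) ∧
    (∀ t ∈ Icc (0:ℝ) 1, γ t = Complex.exp (g t)) ∧
    g 1 - g 0 = ((2 * Real.pi * (n : ℝ) : ℝ) : ℂ) * Complex.I

/-- A loop in `ℝ² ∖ {0}`: a continuous closed curve on `[0,1]` avoiding the origin. -/
def IsLoopIn (γ : ℝ → ℂ) : Prop :=
  ContinuousOn γ (Icc 0 1) ∧ γ 0 = γ 1 ∧ ∀ t ∈ Icc (0:ℝ) 1, γ t ≠ 0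

/-- A decomposition of the closed curve `γ` into `l` subarcs, each of which is free for
`h` (disjoint from its image under `h`). The `h`-length of `γ` is the least such `l`. -/
def Decomp (h : ℂ → ℂ) (γ : ℝ → ℂ) (l : ℕ) : Prop :=
  ∃ t : ℕ → ℝ, t 0 = 0 ∧ t l = 1 ∧ (∀ i < l, t i ≤ t (i + 1)) ∧
    ∀ i < l, ∀ s ∈ Icc (t i) (t (i + 1)), ∀ s' ∈ Icc (t i) (t (i + 1)),
      h (γ s) ≠ γ s'

/-- Orientation preservation, encoded (via Kneser's theorem) as being isotopic to the
identity through bijections of the plane. -/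
def IsotopicToId (h : ℂ → ℂ) : Prop :=
  ∃ F : ℝ → ℂ → ℂ, Continuous (Function.uncurry F) ∧ F 0 = id ∧ F 1 = h ∧
    ∀ t : ℝ, Function.Bijective (F t)

/-- The circle of radius `r` around the origin, as a loop. -/
noncomputable def circleLoop (r : ℝ) (t : ℝ) : ℂ :=
  (r : ℂ) * Complex.exp (((2 * Real.pi * t : ℝ) : ℂ) * Complex.I)

/-- The Poincaré–Lefschetz index of the fixed point `0` of `h` is `n`: for every
circle of radius `r > 0` around `0`, the vector-field loop `t ↦ h(γ_r(t)) − γ_r(t)`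
has degree `n` around `0`. -/
def HasIndex (h : ℂ → ℂ) (n : ℤ) : Prop :=
  ∀ r : ℝ, 0 < r →
    HasDeg (fun t => h (circleLoop r t) - circleLoop r t) n

/-- Along a preconnected set on which a lifted function stays in a rotated slit plane, the
lift is determined up to a constant by the principal logarithm. -/
lemma lift_sub_log_const {X : Type*} [TopologicalSpace X] {S : Set X} (hS : IsPreconnected S)
    {L : X → ℂ} (hL : ContinuousOn L S) (c : ℂ) (hc : c ≠ 0)
    (hs : ∀ x ∈ S, c * Complex.exp (L x) ∈ Complex.slitPlane) {x y : X} (hx : x ∈ S)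
    (hy : y ∈ S) :
    L x - Complex.log (c * Complex.exp (L x)) = L y - Complex.log (c * Complex.exp (L y)) := by
  refine Complex.isCoveringMap_exp.constOn_of_comp hS
    (g := fun x => L x - Complex.log (c * Complex.exp (L x))) ?_ ?_ hx hy
  · refine hL.sub (ContinuousOn.clog ?_ hs)
    exact continuousOn_const.mul (Complex.continuous_exp.comp_continuousOn hL)
  · have key : ∀ a ∈ S, Complex.exp (L a - Complex.log (c * Complex.exp (L a))) = c⁻¹ := by
      intro a _
      rw [Complex.exp_sub, Complex.exp_log (mul_ne_zero hc (Complex.exp_ne_zero _))]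
      field_simp [Complex.exp_ne_zero]
    intro a ha b hb
    exact Subtype.ext ((key a ha).trans (key b hb).symm)

/-- The crossing argument: a nonvanishing map of the plane cannot have the boundary behaviour of
a rectangle winding around the origin. -/
lemma no_crossing (H : ℝ × ℝ → ℂ) (hH : Continuous H) (h0 : ∀ p, H p ≠ 0) (s₀ s₁ T T' : ℝ)
    (hl : ∀ t, 0 ≤ (H (s₀, t)).re) (hr : ∀ t, (H (s₁, t)).re ≤ 0)
    (hs₀ : s₀ ∈ Icc (0:ℝ) 1) (hs₁ : s₁ ∈ Icc (0:ℝ) 1)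
    (ht : ∀ s ∈ Icc (0:ℝ) 1, 0 < (H (s, T)).im) (hb : ∀ s ∈ Icc (0:ℝ) 1, (H (s, T')).im < 0) :
    False := by
  obtain ⟨F, ⟨-, hF⟩, -⟩ := Complex.isCoveringMapOn_exp.existsUnique_continuousMap_lifts
    (⟨H, hH⟩ : C(ℝ × ℝ, ℂ)) (a₀ := (0, 0)) (e₀ := Complex.log (H (0, 0)))
    (Complex.exp_log (h0 _)) (fun a => h0 a)
  have hF' : ∀ p, Complex.exp (F p) = H p := fun p => congrFun hF p
  have hFc : Continuous F := F.continuous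
  have e1 := lift_sub_log_const (S := univ) isPreconnected_univ (L := fun t : ℝ => F (s₀, t))
    (by fun_prop) 1 one_ne_zero (by
      intro t _
      rw [one_mul, hF', Complex.mem_slitPlane_iff]
      by_contra! hcon
      exact h0 (s₀, t) (Complex.ext (le_antisymm hcon.1 (hl t)) hcon.2))
      (mem_univ T) (mem_univ T')
  have e2 := lift_sub_log_const (S := univ) isPreconnected_univ (L := fun t : ℝ => F (s₁, t))
    (by fun_prop) (-1) (by norm_num) (by
      intro t _
      rw [hF', Complex.mem_slitPlane_iff]
      by_contra! hcon
      have h1 := hcon.1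
      have h2 := hcon.2
      simp at h1 h2
      exact h0 (s₁, t) (Complex.ext (le_antisymm (hr t) h1) h2))
      (mem_univ T) (mem_univ T')
  have e3 := lift_sub_log_const (S := Icc (0:ℝ) 1) isPreconnected_Icc
    (L := fun s : ℝ => F (s, T))
    (by fun_prop) 1 one_ne_zero (by
      intro t h
      rw [one_mul, hF', Complex.mem_slitPlane_iff]
      exact Or.inr (ht t h).ne')
      hs₀ hs₁
  have e4 := lift_sub_log_const (S := Icc (0:ℝ) 1) isPreconnected_Icc
    (L := fun s : ℝ => F (s, T'))
    (by fun_prop) 1 one_ne_zero (by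
      intro t h
      rw [one_mul, hF', Complex.mem_slitPlane_iff]
      exact Or.inr (hb t h).ne)
      hs₀ hs₁
  simp only [hF', one_mul, neg_one_mul] at e1 e2 e3 e4
  have e1 := congrArg Complex.im e1
  have e2 := congrArg Complex.im e2
  have e3 := congrArg Complex.im e3
  have e4 := congrArg Complex.im e4
  simp only [Complex.sub_im, Complex.log_im] at e1 e2 e3 e4
  rw [Complex.arg_neg_eq_arg_sub_pi_of_im_pos (ht _ hs₁),
    Complex.arg_neg_eq_arg_add_pi_of_im_neg (hb _ hs₁)] at e2
  linarith [Real.pi_pos]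

/-- A Jordan curve has degree at most one. -/
lemma deg_le_one (γ : ℝ → ℂ) (n : ℤ) (hd : HasDeg γ n) (hinj : InjOn γ (Ico 0 1)) : n ≤ 1 := by
  by_contra! hn
  obtain ⟨g, hgc, hge, hg⟩ := hd
  set w : ℂ := ((2 * Real.pi * (n : ℝ) : ℝ) : ℂ) * Complex.I with hw
  set G : ℝ → ℂ := fun t => ((fun u : ℝ => g u - u * w) ∘ Int.fract) t + t * w with hG
  have hGc : Continuous G := by
    refine Continuous.add (ContinuousOn.comp_fract'' ?_ ?_) (by fun_prop)
    · exact hgc.sub (by fun_prop)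
    · have : g 1 = g 0 + w := by rw [← hg]; ring
      simp [this]
  have hGf : ∀ t, G t = g (Int.fract t) + (⌊t⌋ : ℂ) * w := by
    intro t
    have : ((Int.fract t : ℝ) : ℂ) = t - (⌊t⌋ : ℂ) := by
      rw [← Int.self_sub_floor]; push_cast; ring
    simp only [hG, Function.comp, this]; ring
  have hGexp : ∀ t, Complex.exp (G t) = γ (Int.fract t) := by
    intro t
    rw [hGf, hge _ ⟨Int.fract_nonneg t, (Int.fract_lt_one t).le⟩, Complex.exp_add]
    have : (⌊t⌋ : ℂ) * w = ((⌊t⌋ * n : ℤ) : ℂ) * (2 * Real.pi * Complex.I) := by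
      rw [hw]; push_cast; ring
    rw [this, Complex.exp_int_mul_two_pi_mul_I, mul_one]
  have hGper : ∀ (t : ℝ) (m : ℤ), G (t + m) = G t + m * w := by
    intro t m
    rw [hGf, hGf, Int.fract_add_intCast, Int.floor_add_intCast]; push_cast; ring
  have hre : ∀ t, (G t).re = (G (Int.fract t)).re := by
    intro t
    have := hGper (Int.fract t) ⌊t⌋
    rw [Int.fract_add_floor] at this
    rw [this, hw]; simp
  have hne : ∀ s t, G t - (G s + 2 * Real.pi * Complex.I) ≠ 0 := by
    intro s t h0
    rw [sub_eq_zero] at h0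
    have h1 := hGexp t
    rw [h0, Complex.exp_add, Complex.exp_two_pi_mul_I, mul_one, hGexp] at h1
    have h2 := hinj ⟨Int.fract_nonneg s, Int.fract_lt_one s⟩
      ⟨Int.fract_nonneg t, Int.fract_lt_one t⟩ h1
    obtain ⟨m, hm⟩ := Int.fract_eq_fract.1 h2.symm
    have h3 : t = s + m := by linarith
    rw [h3, hGper] at h0
    have h4 : (m : ℂ) * w = 2 * Real.pi * Complex.I := add_left_cancel h0
    have h5 := congrArg Complex.im h4
    simp [hw] at h5
    have h6 : (m : ℝ) * n = 1 := by
      have := Real.pi_pos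
      have h7 : (2 * Real.pi) * ((m : ℝ) * n) = (2 * Real.pi) * 1 := by linarith
      exact mul_left_cancel₀ (by positivity) h7
    have h7 : m * n = 1 := by exact_mod_cast h6
    rcases Int.eq_one_or_neg_one_of_mul_eq_one' h7 with h | h <;> omega
  obtain ⟨s₀, hs₀, hmin⟩ := isCompact_Icc.exists_isMinOn (nonempty_Icc.2 (zero_le_one (α := ℝ)))
    (Complex.continuous_re.comp hGc).continuousOn
  obtain ⟨s₁, hs₁, hmax⟩ := isCompact_Icc.exists_isMaxOn (nonempty_Icc.2 (zero_le_one (α := ℝ)))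
    (Complex.continuous_re.comp hGc).continuousOn
  obtain ⟨C, hC⟩ := isCompact_Icc.exists_bound_of_continuousOn (s := Icc (0:ℝ) 1)
    (Complex.continuous_im.comp hGc).continuousOn
  obtain ⟨m, hm⟩ := exists_nat_gt (2 * C + 2 * Real.pi)
  have hmem : ∀ t : ℝ, Int.fract t ∈ Icc (0:ℝ) 1 :=
    fun t => ⟨Int.fract_nonneg t, (Int.fract_lt_one t).le⟩
  have hC0 := hC 0 ⟨le_rfl, zero_le_one⟩
  simp only [Function.comp, Real.norm_eq_abs] at hC hC0
  rw [abs_le] at hC0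
  have hnR : (2:ℝ) ≤ n := by exact_mod_cast hn
  have hbig : (m : ℝ) ≤ m * (2 * Real.pi * n) := by
    have : 1 ≤ 2 * Real.pi * n := by nlinarith [Real.pi_gt_three]
    nlinarith [Nat.cast_nonneg (α := ℝ) m]
  have hm0 := hGper 0 m
  have hm1 := hGper 0 (-m)
  rw [zero_add] at hm0 hm1
  push_cast at hm0 hm1
  refine no_crossing (fun p => G p.2 - (G p.1 + 2 * Real.pi * Complex.I)) (by fun_prop)
    (fun p => hne _ _) s₀ s₁ m (-m) ?_ ?_ hs₀ hs₁ ?_ ?_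
  · intro t
    have := hmin (hmem t)
    simp only [mem_ofPred_eq, Function.comp, ← hre] at this
    simpa using this
  · intro t
    have := hmax (hmem t)
    simp only [mem_ofPred_eq, Function.comp, ← hre] at this
    simpa using this
  · intro s hs
    have h1 := abs_le.1 (hC s hs)
    simp only [hm0]
    simp [hw]
    linarith [h1.1, h1.2, hC0.1, hC0.2, Real.pi_pos]
  · intro s hs
    have h1 := abs_le.1 (hC s hs)
    simp only [hm1]
    simp [hw]
    linarith [h1.1, h1.2, hC0.1, hC0.2, Real.pi_pos]

/-- A closed labelled walk of length `N`, with monotone labels. -/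
def IsWalk {V : Type*} (E : V → V → ℕ → Prop) (N : ℕ) (v : ℕ → V) (p : ℕ → ℕ) : Prop :=
  v N = v 0 ∧ (∀ j < N, E (v j) (v (j + 1)) (p j)) ∧ ∀ i j, i ≤ j → j < N → p i ≤ p j

/-- Loop erasure: a closed walk of positive total weight contains a simple one. -/
lemma loop_erase {V : Type*} (E : V → V → ℕ → Prop) (a : V → V → ℝ) :
    ∀ (N : ℕ) (v : ℕ → V) (p : ℕ → ℕ), IsWalk E N v p →
      0 < ∑ j ∈ Finset.range N, a (v j) (v (j + 1)) →
      ∃ (N' : ℕ) (v' : ℕ → V) (p' : ℕ → ℕ), IsWalk E N' v' p' ∧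
        0 < ∑ j ∈ Finset.range N', a (v' j) (v' (j + 1)) ∧
        ∀ i < N', ∀ j < N', v' i = v' j → i = j := by
  intro N
  induction N using Nat.strong_induction_on with
  | _ N ih =>
  intro v p hw hpos
  by_cases hinj : ∀ i < N, ∀ j < N, v i = v j → i = j
  · exact ⟨N, v, p, hw, hpos, hinj⟩
  have : ∃ i j, i < j ∧ j < N ∧ v i = v j := by
    push Not at hinj
    obtain ⟨i, hi, j, hj, hij, hne⟩ := hinj
    rcases lt_or_gt_of_ne hne with h | h
    · exact ⟨i, j, h, hj, hij⟩
    · exact ⟨j, i, h, hi, hij.symm⟩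
  obtain ⟨i, j, hij, hjN, hv⟩ := this
  obtain ⟨d, rfl⟩ := Nat.exists_eq_add_of_lt hij
  obtain ⟨e, rfl⟩ := Nat.exists_eq_add_of_lt hjN
  obtain ⟨hc, hE, hp⟩ := hw
  set D := d + 1 with hD
  set e' := e + 1 with he'
  have hN : i + d + 1 + e + 1 = i + D + e' := by omega
  have hv' : v i = v (i + D) := hv
  have hsum : ∑ k ∈ Finset.range (i + d + 1 + e + 1), a (v k) (v (k + 1))
      = (∑ k ∈ Finset.range D, a (v (i + k)) (v (i + (k + 1)))) +
        ∑ k ∈ Finset.range (i + e'), a (if k < i then v k else v (k + D))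
          (if k + 1 < i then v (k + 1) else v (k + 1 + D)) := by
    rw [hN, Finset.sum_range_add _ (i + D) e', Finset.sum_range_add _ i D,
      Finset.sum_range_add _ i e']
    have h1 : ∑ k ∈ Finset.range i, a (if k < i then v k else v (k + D))
          (if k + 1 < i then v (k + 1) else v (k + 1 + D)) =
        ∑ k ∈ Finset.range i, a (v k) (v (k + 1)) := by
      refine Finset.sum_congr rfl fun k hk => ?_
      rw [Finset.mem_range] at hk
      rw [if_pos hk]
      split_ifs with h
      · rfl
      · have : k + 1 = i := by omega
        rw [this, hv']
    have h2 : ∑ k ∈ Finset.range e', a (if i + k < i then v (i + k) else v (i + k + D))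
          (if i + k + 1 < i then v (i + k + 1) else v (i + k + 1 + D)) =
        ∑ k ∈ Finset.range e', a (v (i + D + k)) (v (i + D + k + 1)) := by
      refine Finset.sum_congr rfl fun k hk => ?_
      rw [if_neg (by omega), if_neg (by omega)]
      congr 2 <;> omega
    rw [h1, h2]
    simp only [add_assoc]
    ring
  rw [hsum] at hpos
  by_cases h1 : 0 < ∑ k ∈ Finset.range D, a (v (i + k)) (v (i + (k + 1)))
  · refine ih D (by omega) (fun k => v (i + k)) (fun k => p (i + k)) ⟨?_, ?_, ?_⟩ h1
    · simpa using hv'.symm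
    · intro k hk
      exact hE (i + k) (by omega)
    · intro k l hkl hl
      exact hp _ _ (by omega) (by omega)
  · have h2 : 0 < ∑ k ∈ Finset.range (i + e'), a (if k < i then v k else v (k + D))
          (if k + 1 < i then v (k + 1) else v (k + 1 + D)) := by linarith
    refine ih (i + e') (by omega) (fun k => if k < i then v k else v (k + D))
      (fun k => if k < i then p k else p (k + D)) ⟨?_, ?_, ?_⟩ h2
    · have h3 : i + e' + D = i + d + 1 + e + 1 := by omega
      simp only [h3, hc]
      rw [if_neg (by omega)]
      split_ifs with h
      · rfl
      · have : i = 0 := by omega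
        subst this
        simpa using hv'
    · intro k hk
      by_cases hki : k < i
      · have := hE k (by omega)
        simp only [hki, if_true]
        split_ifs with h
        · exact this
        · have h3 : k + 1 = i := by omega
          rw [h3] at this ⊢
          rwa [← hv']
      · have := hE (k + D) (by omega)
        simp only [hki, if_false]
        rw [if_neg (by omega)]
        have h3 : k + 1 + D = k + D + 1 := by omega
        rwa [h3]
    · intro k l hkl hl
      dsimp only
      split_ifs <;> exact hp _ _ (by omega) (by omega)

/-- Clamp to the unit interval. -/
noncomputable def cl (x : ℝ) : ℝ := max 0 (min 1 x)

lemma cl_cont : Continuous cl := by unfold cl; fun_prop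

lemma cl_mem (x : ℝ) : cl x ∈ Icc (0:ℝ) 1 :=
  ⟨le_max_left _ _, max_le zero_le_one (min_le_left _ _)⟩

lemma sum_cl {M : Type*} [AddCommMonoid M] (f : ℕ → ℝ → M) (hf : ∀ j, f j 0 = 0) (N k : ℕ)
    (hk : k < N) (u : ℝ) (hu : u ∈ Icc (0:ℝ) 1) :
    ∑ j ∈ Finset.range N, f j (cl (k + u - j)) = ∑ j ∈ Finset.range k, f j 1 + f k u := by
  obtain ⟨e, rfl⟩ := Nat.exists_eq_add_of_lt hk
  have hN : k + e + 1 = k + 1 + e := by omega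
  rw [hN, Finset.sum_range_add, Finset.sum_range_succ]
  have h1 : ∑ j ∈ Finset.range k, f j (cl (k + u - j)) = ∑ j ∈ Finset.range k, f j 1 := by
    refine Finset.sum_congr rfl fun j hj => ?_
    have : (j : ℝ) + 1 ≤ k := by exact_mod_cast Finset.mem_range.1 hj
    congr 1
    unfold cl
    rw [min_eq_left (by linarith [hu.1]), max_eq_right zero_le_one]
  have h2 : ∑ x ∈ Finset.range e, f (k + 1 + x) (cl (k + u - ((k + 1 + x : ℕ) : ℝ))) = 0 := by
    refine Finset.sum_eq_zero fun j _ => ?_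
    have : cl (k + u - ((k + 1 + j : ℕ) : ℝ)) = 0 := by
      unfold cl
      have h0 : (0:ℝ) ≤ j := Nat.cast_nonneg j
      push_cast
      rw [min_eq_right (by linarith [hu.2]), max_eq_left (by linarith [hu.2])]
    rw [this, hf]
  have h3 : cl (k + u - k) = u := by
    unfold cl
    rw [add_sub_cancel_left, min_eq_right hu.2, max_eq_right hu.1]
  rw [h1, h2, h3, add_zero]

/-- Every point of `[0,N]` is in one of the unit subintervals. -/
lemma exists_unit (N : ℕ) (hN : 0 < N) (x : ℝ) (hx : x ∈ Icc (0:ℝ) N) :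
    ∃ k < N, ∃ u ∈ Icc (0:ℝ) 1, x = k + u := by
  by_cases h : x < N
  · refine ⟨⌊x⌋₊, (Nat.floor_lt hx.1).2 h, x - ⌊x⌋₊, ⟨?_, ?_⟩, by ring⟩
    · linarith [Nat.floor_le hx.1]
    · linarith [Nat.lt_floor_add_one x]
  · have : x = N := le_antisymm hx.2 (not_lt.1 h)
    refine ⟨N - 1, by omega, 1, ⟨zero_le_one, le_rfl⟩, ?_⟩
    rw [this, Nat.cast_sub hN]; simp

/-- The piecewise linear curve through the points `v 0, …, v N`. -/
noncomputable def pl (N : ℕ) (v : ℕ → ℂ) (x : ℝ) : ℂ :=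
  v 0 + ∑ j ∈ Finset.range N, ((cl (x - j) : ℝ) : ℂ) * (v (j + 1) - v j)

lemma pl_cont (N : ℕ) (v : ℕ → ℂ) : Continuous (pl N v) := by
  have := cl_cont
  unfold pl; fun_prop

lemma pl_eval (N : ℕ) (v : ℕ → ℂ) (k : ℕ) (hk : k < N) (u : ℝ) (hu : u ∈ Icc (0:ℝ) 1) :
    pl N v (k + u) = v k + u * (v (k + 1) - v k) := by
  unfold pl
  rw [sum_cl (fun j (x : ℝ) => (x : ℂ) * (v (j + 1) - v j)) (by simp) N k hk u hu]
  simp only [Complex.ofReal_one, one_mul]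
  rw [Finset.sum_range_sub]; ring

/-- The lift of the piecewise linear curve. -/
noncomputable def plLift (N : ℕ) (v : ℕ → ℂ) (x : ℝ) : ℂ :=
  Complex.log (v 0) +
    ∑ j ∈ Finset.range N, Complex.log (1 + ((cl (x - j) : ℝ) : ℂ) * (v (j + 1) / v j - 1))

lemma slit_of_seg (v w : ℂ) (h : ∀ u ∈ Icc (0:ℝ) 1, v + u * (w - v) ≠ 0) (u : ℝ)
    (hu : u ∈ Icc (0:ℝ) 1) : 1 + (u : ℂ) * (w / v - 1) ∈ Complex.slitPlane := by
  have hv : v ≠ 0 := by simpa using h 0 ⟨le_rfl, zero_le_one⟩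
  set z := w / v with hz
  have h' : ∀ u ∈ Icc (0:ℝ) 1, 1 + (u : ℂ) * (z - 1) ≠ 0 := by
    intro u hu h0
    apply h u hu
    have : v + u * (w - v) = v * (1 + (u : ℂ) * (z - 1)) := by rw [hz]; field_simp
    rw [this, h0, mul_zero]
  rw [Complex.mem_slitPlane_iff]
  by_contra! hcon
  obtain ⟨h1, h2⟩ := hcon
  simp at h1 h2
  have hu0 : u ≠ 0 := by
    rintro rfl
    norm_num at h1
  have hzi : z.im = 0 := by
    rcases h2 with h2 | h2
    · exact absurd h2 hu0
    · exact h2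
  have hzr : z.re ≤ 0 := by
    by_contra! hc
    nlinarith [hu.1, hu.2, mul_nonneg hu.1 hc.le]
  refine h' (1 / (1 - z.re)) ⟨by apply div_nonneg <;> linarith, ?_⟩ ?_
  · rw [div_le_one (by linarith)]; linarith
  · have h3 : (1 - z.re) ≠ 0 := by linarith
    apply Complex.ext
    · simp only [Complex.add_re, Complex.one_re, Complex.re_ofReal_mul, Complex.sub_re,
        Complex.zero_re]
      field_simp; ring
    · simp only [Complex.add_im, Complex.one_im, Complex.im_ofReal_mul, Complex.sub_im,
        Complex.zero_im, hzi]
      simp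

lemma plLift_cont (N : ℕ) (v : ℕ → ℂ)
    (h : ∀ j < N, ∀ u ∈ Icc (0:ℝ) 1, v j + u * (v (j + 1) - v j) ≠ 0) :
    Continuous (plLift N v) := by
  have := cl_cont
  unfold plLift
  refine continuous_const.add (continuous_finsetSum _ fun j hj => ?_)
  refine Continuous.clog (by fun_prop) fun x => ?_
  exact slit_of_seg _ _ (h j (Finset.mem_range.1 hj)) _ (cl_mem _)

lemma sum_log_exp (v : ℕ → ℂ) (k : ℕ) (h : ∀ j ≤ k, v j ≠ 0) :
    Complex.exp (Complex.log (v 0) + ∑ j ∈ Finset.range k, Complex.log (v (j + 1) / v j)) = v k := by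
  induction k with
  | zero => simpa using Complex.exp_log (h 0 le_rfl)
  | succ k ih =>
    rw [Finset.sum_range_succ, ← add_assoc, Complex.exp_add, ih fun j hj => h j (by omega),
      Complex.exp_log (div_ne_zero (h _ le_rfl) (h _ (by omega)))]
    have := h k (by omega)
    field_simp

lemma plLift_eval (N : ℕ) (v : ℕ → ℂ) (k : ℕ) (hk : k < N) (u : ℝ) (hu : u ∈ Icc (0:ℝ) 1) :
    plLift N v (k + u) = Complex.log (v 0) + (∑ j ∈ Finset.range k, Complex.log (v (j + 1) / v j)
      + Complex.log (1 + (u : ℂ) * (v (k + 1) / v k - 1))) := by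
  unfold plLift
  rw [sum_cl (fun j (x : ℝ) => Complex.log (1 + (x : ℂ) * (v (j + 1) / v j - 1))) (by simp) N k
    hk u hu]
  simp

lemma plLift_exp (N : ℕ) (v : ℕ → ℂ)
    (h : ∀ j < N, ∀ u ∈ Icc (0:ℝ) 1, v j + u * (v (j + 1) - v j) ≠ 0)
    (k : ℕ) (hk : k < N) (u : ℝ) (hu : u ∈ Icc (0:ℝ) 1) :
    Complex.exp (plLift N v (k + u)) = pl N v (k + u) := by
  have h0 : ∀ j < N, v j ≠ 0 := fun j hj => by simpa using h j hj 0 ⟨le_rfl, zero_le_one⟩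
  rw [plLift_eval N v k hk u hu, pl_eval N v k hk u hu, ← add_assoc, Complex.exp_add,
    sum_log_exp v k (fun j hj => h0 j (by omega)),
    Complex.exp_log (Complex.slitPlane_ne_zero (slit_of_seg _ _ (h k hk) u hu))]
  have := h0 k hk
  field_simp

/-- Degree of a closed polygon. -/
lemma pl_hasDeg (N : ℕ) (hN : 0 < N) (v : ℕ → ℂ) (hc : v N = v 0)
    (h : ∀ j < N, ∀ u ∈ Icc (0:ℝ) 1, v j + u * (v (j + 1) - v j) ≠ 0) :
    ∃ n : ℤ, HasDeg (fun t => pl N v (N * t)) n ∧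
      ∑ j ∈ Finset.range N, (v (j + 1) / v j).arg = 2 * Real.pi * n := by
  have h0 : ∀ j ≤ N, v j ≠ 0 := fun j hj => by
    rcases hj.lt_or_eq with hj | rfl
    · simpa using h j hj 0 ⟨le_rfl, zero_le_one⟩
    · rw [hc]; simpa using h 0 hN 0 ⟨le_rfl, zero_le_one⟩
  have h1 := sum_log_exp v N h0
  rw [Complex.exp_add, Complex.exp_log (h0 0 (by omega)), hc] at h1
  have h2 : Complex.exp (∑ j ∈ Finset.range N, Complex.log (v (j + 1) / v j)) = 1 :=
    mul_left_cancel₀ (h0 0 (by omega)) (h1.trans (mul_one _).symm)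
  obtain ⟨n, hn⟩ := Complex.exp_eq_one_iff.1 h2
  refine ⟨n, ⟨fun t => plLift N v (N * t), ?_, ?_, ?_⟩, ?_⟩
  · have := plLift_cont N v h
    exact Continuous.continuousOn (by fun_prop)
  · intro t ht
    obtain ⟨k, hk, u, hu, hx⟩ := exists_unit N hN (N * t)
      ⟨mul_nonneg (Nat.cast_nonneg _) ht.1, mul_le_of_le_one_right (Nat.cast_nonneg _) ht.2⟩
    dsimp only
    rw [hx, plLift_exp N v h k hk u hu]
  · have e0 := plLift_eval N v 0 hN 0 ⟨le_rfl, zero_le_one⟩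
    have e1 := plLift_eval N v (N - 1) (by omega) 1 ⟨zero_le_one, le_rfl⟩
    obtain ⟨M, rfl⟩ : ∃ M, N = M + 1 := ⟨N - 1, by omega⟩
    simp only [Nat.add_sub_cancel, Complex.ofReal_one, one_mul, add_sub_cancel,
      ← Finset.sum_range_succ, hn] at e1
    simp at e0
    push_cast
    simp only [mul_one, mul_zero, e0, e1]
    ring
  · have := congrArg Complex.im hn
    simp only [Complex.im_sum, Complex.log_im] at this
    rw [this]; simp; ring

/-- Grid adjacency (or equality). -/
def GAdj (z w : ℤ × ℤ) : Prop :=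
  (z.1 = w.1 ∧ |z.2 - w.2| ≤ 1) ∨ (z.2 = w.2 ∧ |z.1 - w.1| ≤ 1)

/-- Grid points with mesh `δ`. -/
noncomputable def pt (δ : ℝ) (z : ℤ × ℤ) : ℂ := ⟨δ * z.1, δ * z.2⟩

lemma gadj_cases {z w : ℤ × ℤ} (h : GAdj z w) (hne : z ≠ w) :
    (w.1 = z.1 ∧ (w.2 = z.2 + 1 ∨ w.2 = z.2 - 1)) ∨
    (w.2 = z.2 ∧ (w.1 = z.1 + 1 ∨ w.1 = z.1 - 1)) := by
  rcases h with ⟨h1, h2⟩ | ⟨h1, h2⟩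
  · left
    refine ⟨h1.symm, ?_⟩
    rw [abs_le] at h2
    have : z.2 ≠ w.2 := fun h => hne (Prod.ext h1 h)
    omega
  · right
    refine ⟨h1.symm, ?_⟩
    rw [abs_le] at h2
    have : z.1 ≠ w.1 := fun h => hne (Prod.ext h h1)
    omega

lemma int_near {a c : ℤ} {x : ℝ} (h : (a : ℝ) = c + x) (h1 : -2 < x) (h2 : x < 2) :
    a = c - 1 ∨ a = c ∨ a = c + 1 := by
  have h3 : (a : ℝ) < ((c + 2 : ℤ) : ℝ) := by push_cast; linarith
  have h4 : ((c - 2 : ℤ) : ℝ) < a := by push_cast; linarith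
  have h5 : a < c + 2 := by exact_mod_cast h3
  have h6 : c - 2 < a := by exact_mod_cast h4
  omega

lemma edge_cross {z z' w w' : ℤ × ℤ} (hz : GAdj z z') (hzn : z ≠ z') (hw : GAdj w w')
    (hwn : w ≠ w') {u u' : ℝ} (hu : u ∈ Ico (0:ℝ) 1) (hu' : u' ∈ Ico (0:ℝ) 1)
    (h1 : (z.1 : ℝ) + u * (z'.1 - z.1) = w.1 + u' * (w'.1 - w.1))
    (h2 : (z.2 : ℝ) + u * (z'.2 - z.2) = w.2 + u' * (w'.2 - w.2)) :
    z = w ∨ (z = w' ∧ z' = w) := by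
  obtain ⟨a, b⟩ := z
  obtain ⟨a', b'⟩ := z'
  obtain ⟨c, d⟩ := w
  obtain ⟨c', d'⟩ := w'
  have e1 := gadj_cases hz hzn
  have e2 := gadj_cases hw hwn
  obtain ⟨hu0, hu1⟩ := hu
  obtain ⟨hu0', hu1'⟩ := hu'
  clear hz hzn hw hwn
  simp only [Prod.mk.injEq] at *
  have ha : a = c - 1 ∨ a = c ∨ a = c + 1 := by
    apply int_near (x := u' * (c' - c) - u * (a' - a)) (by linarith) <;>
    rcases e1 with ⟨rfl, rfl | rfl⟩ | ⟨rfl, rfl | rfl⟩ <;>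
    rcases e2 with ⟨rfl, rfl | rfl⟩ | ⟨rfl, rfl | rfl⟩ <;> push_cast <;> linarith
  have hb : b = d - 1 ∨ b = d ∨ b = d + 1 := by
    apply int_near (x := u' * (d' - d) - u * (b' - b)) (by linarith) <;>
    rcases e1 with ⟨rfl, rfl | rfl⟩ | ⟨rfl, rfl | rfl⟩ <;>
    rcases e2 with ⟨rfl, rfl | rfl⟩ | ⟨rfl, rfl | rfl⟩ <;> push_cast <;> linarith
  rcases e1 with ⟨rfl, rfl | rfl⟩ | ⟨rfl, rfl | rfl⟩ <;>
  rcases e2 with ⟨rfl, rfl | rfl⟩ | ⟨rfl, rfl | rfl⟩ <;>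
  rcases ha with rfl | rfl | rfl <;> rcases hb with rfl | rfl | rfl <;>
  push_cast at h1 h2 <;>
  first
  | exact Or.inl ⟨rfl, rfl⟩
  | (exfalso; linarith)
  | (right; refine ⟨⟨?_, ?_⟩, ?_, ?_⟩ <;> ring)

lemma pt_seg_re (δ : ℝ) (z w : ℤ × ℤ) (u : ℝ) :
    (pt δ z + u * (pt δ w - pt δ z)).re = δ * (z.1 + u * (w.1 - z.1)) := by
  simp [pt]; ring

lemma pt_seg_im (δ : ℝ) (z w : ℤ × ℤ) (u : ℝ) :
    (pt δ z + u * (pt δ w - pt δ z)).im = δ * (z.2 + u * (w.2 - z.2)) := by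
  simp [pt]; ring

/-- A simple closed grid polygon is a Jordan curve. -/
lemma grid_inj (δ : ℝ) (hδ : 0 < δ) (N : ℕ) (hN : 3 ≤ N) (v : ℕ → ℤ × ℤ) (hc : v N = v 0)
    (hadj : ∀ j < N, GAdj (v j) (v (j + 1)))
    (hinj : ∀ i < N, ∀ j < N, v i = v j → i = j) :
    InjOn (fun t : ℝ => pl N (fun j => pt δ (v j)) (N * t)) (Ico 0 1) := by
  have hN0 : (0:ℝ) < N := by exact_mod_cast (by omega : 0 < N)
  have hsucc : ∀ j < N, ∀ k < N, v j = v (k + 1) → j = k + 1 ∨ (j = 0 ∧ k + 1 = N) := by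
    intro j hj k hk h
    rcases Nat.lt_or_ge (k + 1) N with h' | h'
    · exact Or.inl (hinj _ hj _ h' h)
    · have e : k + 1 = N := by omega
      rw [e, hc] at h
      exact Or.inr ⟨hinj _ hj _ (by omega) h, e⟩
  have hne : ∀ j < N, v j ≠ v (j + 1) := by
    intro j hj h
    rcases hsucc j hj j hj h with h | h <;> omega
  have hdec : ∀ t ∈ Ico (0:ℝ) 1, ∃ k < N, ∃ u ∈ Ico (0:ℝ) 1, N * t = k + u := by
    intro t ht
    have h0 : 0 ≤ N * t := mul_nonneg hN0.le ht.1
    refine ⟨⌊N * t⌋₊, (Nat.floor_lt h0).2 (by nlinarith [ht.2]), N * t - ⌊N * t⌋₊, ⟨?_, ?_⟩,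
      by ring⟩
    · linarith [Nat.floor_le h0]
    · linarith [Nat.lt_floor_add_one (N * t)]
  intro s hs t ht hst
  obtain ⟨j, hj, u, hu, hsu⟩ := hdec s hs
  obtain ⟨k, hk, u', hu', htu⟩ := hdec t ht
  dsimp only at hst
  rw [hsu, htu, pl_eval _ _ j hj u (Ico_subset_Icc_self hu),
    pl_eval _ _ k hk u' (Ico_subset_Icc_self hu')] at hst
  have h1 := congrArg Complex.re hst
  have h2 := congrArg Complex.im hst
  rw [pt_seg_re, pt_seg_re] at h1
  rw [pt_seg_im, pt_seg_im] at h2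
  have h1 := mul_left_cancel₀ hδ.ne' h1
  have h2 := mul_left_cancel₀ hδ.ne' h2
  have hjk : j = k := by
    rcases edge_cross (hadj j hj) (hne j hj) (hadj k hk) (hne k hk) hu hu' h1 h2 with h | ⟨h, h'⟩
    · exact hinj _ hj _ hk h
    · have e1 := hsucc j hj k hk h
      have e2 := hsucc k hk j hj h'.symm
      omega
  subst hjk
  have huu : u = u' := by
    rcases gadj_cases (hadj j hj) (hne j hj) with ⟨_, h | h⟩ | ⟨_, h | h⟩
    · rw [h] at h2; push_cast at h2; linarith
    · rw [h] at h2; push_cast at h2; linarith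
    · rw [h] at h1; push_cast at h1; linarith
    · rw [h] at h1; push_cast at h1; linarith
  have : (N : ℝ) * s = N * t := by rw [hsu, htu, huu]
  exact mul_left_cancel₀ hN0.ne' this

/-- A labelled walk gives a decomposition of the polygon. -/
lemma walk_decomp (h : ℂ → ℂ) (U : ℕ → Set ℂ) (l N : ℕ) (hN : 0 < N) (v : ℕ → ℂ) (p : ℕ → ℕ)
    (hfree : ∀ i < l, ∀ x ∈ U i, ∀ y ∈ U i, h x ≠ y)
    (hp : ∀ i j, i ≤ j → j < N → p i ≤ p j) (hpl : ∀ j < N, p j < l)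
    (hU : ∀ j < N, ∀ u ∈ Icc (0:ℝ) 1, v j + u * (v (j + 1) - v j) ∈ U (p j)) :
    Decomp h (fun t => pl N v (N * t)) l := by
  classical
  have hN0 : (0:ℝ) < N := by exact_mod_cast hN
  have hex : ∀ i, ∃ j, N ≤ j ∨ i ≤ p j := fun i => ⟨N, Or.inl le_rfl⟩
  set n : ℕ → ℕ := fun i => Nat.find (hex i) with hn
  have hnN : ∀ i, n i ≤ N := fun i => Nat.find_min' (hex i) (Or.inl le_rfl)
  have hnlt : ∀ i j, j < n i → p j < i := by
    intro i j hj
    have := Nat.find_min (hex i) hj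
    push Not at this
    exact this.2
  have hnge : ∀ i j, n i ≤ j → j < N → i ≤ p j := by
    intro i j hj hjN
    rcases Nat.find_spec (hex i) with h1 | h1
    · have : N ≤ n i := h1
      omega
    · exact h1.trans (hp _ _ hj hjN)
  have hnmono : ∀ i, n i ≤ n (i + 1) := by
    intro i
    apply Nat.find_min' (hex i)
    rcases Nat.find_spec (hex (i + 1)) with h1 | h1
    · exact Or.inl h1
    · exact Or.inr (le_trans (Nat.le_succ i) h1)
  have hn0 : n 0 = 0 := by
    have : n 0 ≤ 0 := Nat.find_min' (hex 0) (Or.inr (Nat.zero_le _))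
    omega
  have hnl : n l = N := by
    refine le_antisymm (hnN l) ?_
    by_contra! hc
    have := hnge l (n l) le_rfl hc
    have := hpl _ hc
    omega
  have hpt : ∀ x ∈ Icc (0:ℝ) N, h (pl N v x) ≠ pl N v x := by
    intro x hx
    obtain ⟨k, hk, u, hu, rfl⟩ := exists_unit N hN x hx
    rw [pl_eval N v k hk u hu]
    exact hfree _ (hpl k hk) _ (hU k hk u hu) _ (hU k hk u hu)
  have hmemU : ∀ i, n i < n (i + 1) → ∀ x ∈ Icc (n i : ℝ) (n (i + 1)), pl N v x ∈ U i := by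
    intro i hi x hx
    obtain ⟨k, hk, u, hu, hx'⟩ := exists_unit (n (i + 1) - n i) (by omega) (x - n i)
      ⟨by linarith [hx.1], by rw [Nat.cast_sub hi.le]; linarith [hx.2]⟩
    have hx'' : x = ((n i + k : ℕ) : ℝ) + u := by push_cast; linarith
    have h1 : n i + k < n (i + 1) := by omega
    have h2 : n i + k < N := h1.trans_le (hnN _)
    have h3 : p (n i + k) = i := by
      have := hnlt _ _ h1
      have := hnge i (n i + k) (by omega) h2
      omega
    rw [hx'', pl_eval N v _ h2 u hu]
    have := hU _ h2 u hu
    rwa [h3] at this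
  refine ⟨fun i => n i / N, by simp [hn0], ?_, ?_, ?_⟩
  · simp only [hnl]; exact div_self hN0.ne'
  · intro i _
    have : (n i : ℝ) ≤ n (i + 1) := by exact_mod_cast hnmono i
    exact div_le_div_of_nonneg_right this hN0.le
  · intro i hi s hs s' hs'
    have hmem : ∀ s ∈ Icc ((n i : ℝ) / N) (n (i + 1) / N), N * s ∈ Icc (n i : ℝ) (n (i + 1)) := by
      intro s hs
      have h1 := (div_le_iff₀ hN0).1 hs.1
      have h2 := (le_div_iff₀ hN0).1 hs.2
      exact ⟨by linarith, by linarith⟩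
    have m1 := hmem s hs
    have m2 := hmem s' hs'
    rcases (hnmono i).lt_or_eq with hlt | heq
    · exact hfree i hi _ (hmemU i hlt _ m1) _ (hmemU i hlt _ m2)
    · rw [← heq] at m1 m2
      have e : (N:ℝ) * s = N * s' := by
        rw [le_antisymm m1.2 m1.1, le_antisymm m2.2 m2.1]
      dsimp only
      rw [← e]
      refine hpt _ ⟨le_trans (Nat.cast_nonneg _) m1.1, m1.2.trans ?_⟩
      exact_mod_cast hnN i

lemma floor_err (δ : ℝ) (hδ : 0 < δ) (x : ℝ) : |δ * ⌊x / δ⌋ - x| ≤ δ := by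
  have h1 := Int.floor_le (x / δ)
  have h2 := Int.lt_floor_add_one (x / δ)
  have e : x = δ * (x / δ) := by field_simp
  rw [abs_le]
  constructor <;> nlinarith

lemma floor_near (δ : ℝ) (hδ : 0 < δ) (x y : ℝ) (h : |x - y| < δ) :
    |⌊x / δ⌋ - ⌊y / δ⌋| ≤ 1 := by
  have h1 := Int.floor_le (x / δ)
  have h2 := Int.lt_floor_add_one (x / δ)
  have h3 := Int.floor_le (y / δ)
  have h4 := Int.lt_floor_add_one (y / δ)
  have h5 : |x / δ - y / δ| < 1 := by
    rw [← sub_div, abs_div, abs_of_pos hδ, div_lt_one hδ]; exact h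
  rw [abs_lt] at h5
  have h6 : (⌊x / δ⌋ : ℝ) < ((⌊y / δ⌋ + 2 : ℤ) : ℝ) := by push_cast; linarith
  have h7 : (⌊y / δ⌋ : ℝ) < ((⌊x / δ⌋ + 2 : ℤ) : ℝ) := by push_cast; linarith
  have h6 : ⌊x / δ⌋ < ⌊y / δ⌋ + 2 := by exact_mod_cast h6
  have h7 : ⌊y / δ⌋ < ⌊x / δ⌋ + 2 := by exact_mod_cast h7
  rw [abs_le]; omega

/-- Uniform subdivision for a continuous function on the unit interval. -/
lemma unif_sub (f : ℝ → ℂ) (hf : ContinuousOn f (Icc 0 1)) (η : ℝ) (hη : 0 < η) :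
    ∃ θ > 0, ∀ s ∈ Icc (0:ℝ) 1, ∀ t ∈ Icc (0:ℝ) 1, |s - t| < θ → ‖f s - f t‖ < η := by
  have := isCompact_Icc.uniformContinuousOn_of_continuous hf
  rw [Metric.uniformContinuousOn_iff] at this
  obtain ⟨θ, hθ, h⟩ := this η hη
  refine ⟨θ, hθ, fun s hs t ht hst => ?_⟩
  have := h s hs t ht (by rwa [Real.dist_eq])
  rwa [dist_eq_norm] at this

lemma initial_walk (γ : ℝ → ℂ) (hγ : IsLoopIn γ) (hd : HasDeg γ 1) (l : ℕ) (t : ℕ → ℝ)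
    (t0 : t 0 = 0) (tl : t l = 1) (ε : ℝ) (hε : 0 < ε) :
    ∃ δ > 0, ∃ (N : ℕ) (v : ℕ → ℤ × ℤ) (p : ℕ → ℕ),
      IsWalk (fun z w i => GAdj z w ∧ i < l ∧ ∀ u ∈ Icc (0:ℝ) 1,
        pt δ z + u * (pt δ w - pt δ z) ∈ Metric.thickening ε (γ '' Icc (t i) (t (i + 1)))) N v p ∧
      ∑ j ∈ Finset.range N, (pt δ (v (j + 1)) / pt δ (v j)).arg = 2 * Real.pi := by
  classical
  obtain ⟨hγc, hγ01, hγ0⟩ := hγ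
  obtain ⟨g, hgc, hge, hg⟩ := hd
  -- lower bound for the modulus
  obtain ⟨m, hm, hmb⟩ : ∃ m > 0, ∀ s ∈ Icc (0:ℝ) 1, m ≤ ‖γ s‖ := by
    obtain ⟨s, hs, hmin⟩ := isCompact_Icc.exists_isMinOn
      (nonempty_Icc.2 (zero_le_one (α := ℝ))) hγc.norm
    exact ⟨‖γ s‖, norm_pos_iff.2 (hγ0 s hs), fun s' hs' => hmin hs'⟩
  set ε' := min ε (m / 2) with hε'
  have hε'0 : 0 < ε' := lt_min hε (by linarith)
  set δ := ε' / 8 with hδdef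
  have hδ : 0 < δ := by positivity
  obtain ⟨θ₁, hθ₁, hu1⟩ := unif_sub γ hγc δ hδ
  obtain ⟨θ₂, hθ₂, hu2⟩ := unif_sub g hgc 1 one_pos
  obtain ⟨M₀, hM₀⟩ := exists_nat_gt (1 / min θ₁ θ₂)
  set M := M₀ + 1 with hMdef
  have hθ : 0 < min θ₁ θ₂ := lt_min hθ₁ hθ₂
  have hM : (0:ℝ) < M := by positivity
  have hMθ : 1 / (M:ℝ) < min θ₁ θ₂ := by
    rw [div_lt_comm₀ hM hθ]
    refine hM₀.trans ?_
    rw [hMdef]; push_cast; linarith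
  set s : ℕ → ℝ := fun k => k / M with hs
  have hsm : ∀ k ≤ M, s k ∈ Icc (0:ℝ) 1 := by
    intro k hk
    refine ⟨by positivity, ?_⟩
    rw [hs, div_le_one hM]
    exact_mod_cast hk
  have hsd : ∀ k, |s (k + 1) - s k| < min θ₁ θ₂ := by
    intro k
    have : s (k + 1) - s k = 1 / M := by
      simp only [hs]; push_cast; ring
    rw [this, abs_of_pos (by positivity)]; exact hMθ
  have hγd : ∀ k < M, ‖γ (s (k + 1)) - γ (s k)‖ < δ := fun k hk =>
    hu1 _ (hsm _ hk) _ (hsm _ hk.le) ((hsd k).trans_le (min_le_left _ _))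
  have hgd : ∀ k < M, ‖g (s (k + 1)) - g (s k)‖ < 1 := fun k hk =>
    hu2 _ (hsm _ hk) _ (hsm _ hk.le) ((hsd k).trans_le (min_le_right _ _))
  have hsmono : ∀ i j, i ≤ j → s i ≤ s j := by
    intro i j hij
    have : (i:ℝ) ≤ j := by exact_mod_cast hij
    exact div_le_div_of_nonneg_right this hM.le
  have hs0 : s 0 = 0 := by simp [hs]
  have hsM : s M = 1 := div_self hM.ne'
  have hl : 0 < l := by
    rcases Nat.eq_zero_or_pos l with h | h
    · rw [h, t0] at tl; norm_num at tl
    · exact h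
  have hex : ∀ k : ℕ, ∃ i, s k ≤ t (i + 1) ∨ l ≤ i + 1 := fun k => ⟨l, Or.inr (by omega)⟩
  set q : ℕ → ℕ := fun k => Nat.find (hex k) with hq
  have hql : ∀ k, q k < l := by
    intro k
    have : q k ≤ l - 1 := Nat.find_min' (hex k) (Or.inr (by omega))
    omega
  have hqmono : ∀ i j, i ≤ j → q i ≤ q j := by
    intro i j hij
    apply Nat.find_min' (hex i)
    rcases Nat.find_spec (hex j) with h | h
    · exact Or.inl ((hsmono _ _ hij).trans h)
    · exact Or.inr h
  have hqmem : ∀ k ≤ M, s k ∈ Icc (t (q k)) (t (q k + 1)) := by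
    intro k hk
    constructor
    · rcases Nat.eq_zero_or_pos (q k) with h | h
      · rw [h, t0]; exact (hsm k hk).1
      · have := Nat.find_min (hex k) (m := q k - 1) (by change q k - 1 < q k; omega)
        push Not at this
        have e : q k - 1 + 1 = q k := by omega
        rw [e] at this
        exact this.1.le
    · rcases Nat.find_spec (hex k) with h | h
      · exact h
      · have h' : l ≤ q k + 1 := h
        have : q k + 1 = l := by have := hql k; omega
        rw [this, tl]; exact (hsm k hk).2
  -- the walk
  set v : ℕ → ℤ × ℤ := fun j =>
    (⌊(γ (s ((j + 1) / 2))).re / δ⌋, ⌊(γ (s (j / 2))).im / δ⌋) with hv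
  -- distance estimate
  have hre : ∀ k < M, ∀ i, i = k ∨ i = k + 1 →
      |δ * ⌊(γ (s i)).re / δ⌋ - (γ (s k)).re| ≤ 2 * δ := by
    intro k hk i hi
    have h1 := floor_err δ hδ (γ (s i)).re
    rcases hi with rfl | rfl
    · linarith
    · have h2 := (Complex.abs_re_le_norm _).trans (hγd k hk).le
      rw [Complex.sub_re] at h2
      have := abs_sub_le (δ * ⌊(γ (s (k + 1))).re / δ⌋) (γ (s (k + 1))).re (γ (s k)).re
      linarith
  have him : ∀ k < M, ∀ i, i = k ∨ i = k + 1 →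
      |δ * ⌊(γ (s i)).im / δ⌋ - (γ (s k)).im| ≤ 2 * δ := by
    intro k hk i hi
    have h1 := floor_err δ hδ (γ (s i)).im
    rcases hi with rfl | rfl
    · linarith
    · have h2 := (Complex.abs_im_le_norm _).trans (hγd k hk).le
      rw [Complex.sub_im] at h2
      have := abs_sub_le (δ * ⌊(γ (s (k + 1))).im / δ⌋) (γ (s (k + 1))).im (γ (s k)).im
      linarith
  have hdist : ∀ k < M, ∀ j, j = 2 * k ∨ j = 2 * k + 1 ∨ j = 2 * k + 2 →
      ‖pt δ (v j) - γ (s k)‖ ≤ 4 * δ := by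
    intro k hk j hj
    refine (Complex.norm_le_abs_re_add_abs_im _).trans ?_
    have h1 := hre k hk ((j + 1) / 2) (by omega)
    have h2 := him k hk (j / 2) (by omega)
    simp only [pt, hv, Complex.sub_re, Complex.sub_im]
    linarith
  have hvN : v (2 * M) = v 0 := by
    have e1 : (2 * M + 1) / 2 = M := by omega
    have e2 : 2 * M / 2 = M := by omega
    simp only [hv, e1, e2, hsM, hs0, hγ01]
  have hsmall : 4 * δ < ε' := by rw [hδdef]; linarith
  refine ⟨δ, hδ, 2 * M, v, fun j => q (j / 2), ⟨hvN, ?_, ?_⟩, ?_⟩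
  · intro j hj
    have hk : j / 2 < M := by omega
    refine ⟨?_, hql _, ?_⟩
    · rcases Nat.even_or_odd' j with ⟨k, rfl | rfl⟩
      · right
        have e1 : (2 * k + 1 + 1) / 2 = k + 1 := by omega
        have e2 : (2 * k + 1) / 2 = k := by omega
        have e3 : 2 * k / 2 = k := by omega
        simp only [hv, e1, e2, e3, true_and]
        apply floor_near δ hδ
        rw [abs_sub_comm, ← Complex.sub_re]
        exact (Complex.abs_re_le_norm _).trans_lt (hγd k (by omega))
      · left
        have e1 : (2 * k + 1 + 1) / 2 = k + 1 := by omega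
        have e2 : (2 * k + 1 + 1 + 1) / 2 = k + 1 := by omega
        have e3 : (2 * k + 1) / 2 = k := by omega
        simp only [hv, e1, e2, e3, true_and]
        apply floor_near δ hδ
        rw [abs_sub_comm, ← Complex.sub_im]
        exact (Complex.abs_im_le_norm _).trans_lt (hγd k (by omega))
    · intro u hu
      rw [Metric.mem_thickening_iff]
      refine ⟨γ (s (j / 2)), mem_image_of_mem _ (hqmem _ hk.le), ?_⟩
      have h1 := hdist (j / 2) hk j (by omega)
      have h2 := hdist (j / 2) hk (j + 1) (by omega)
      have e : pt δ (v j) + u * (pt δ (v (j + 1)) - pt δ (v j)) - γ (s (j / 2))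
          = ((1 - u : ℝ) : ℂ) * (pt δ (v j) - γ (s (j / 2)))
            + (u : ℂ) * (pt δ (v (j + 1)) - γ (s (j / 2))) := by push_cast; ring
      rw [dist_eq_norm, e]
      refine lt_of_le_of_lt (norm_add_le _ _) ?_
      rw [norm_mul, norm_mul, Complex.norm_real, Complex.norm_real, Real.norm_eq_abs,
        Real.norm_eq_abs, abs_of_nonneg (by linarith [hu.2] : 0 ≤ 1 - u), abs_of_nonneg hu.1]
      have h3 := mul_le_mul_of_nonneg_left h1 (by linarith [hu.2] : 0 ≤ 1 - u)
      have h4 := mul_le_mul_of_nonneg_left h2 hu.1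
      have h5 : ε' ≤ ε := min_le_left _ _
      nlinarith
  · intro i j hij _
    exact hqmono _ _ (by omega)
  ·
    have hq1 : ∀ k < M, ∀ j, j = 2 * k ∨ j = 2 * k + 1 ∨ j = 2 * k + 2 →
        ‖pt δ (v j) / γ (s k) - 1‖ ≤ 1 / 2 := by
      intro k hk j hj
      have hne := hγ0 _ (hsm k hk.le)
      have e : pt δ (v j) / γ (s k) - 1 = (pt δ (v j) - γ (s k)) / γ (s k) := by field_simp
      have hb := hmb _ (hsm k hk.le)
      rw [e, norm_div, div_le_iff₀ (norm_pos_iff.2 hne)]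
      have h1 := hdist k hk j hj
      have h2 : ε' ≤ m / 2 := min_le_right _ _
      linarith
    have hlog : ∀ z : ℂ, ‖z - 1‖ ≤ 1 / 2 → |(Complex.log z).im| ≤ 3 / 4 ∧ z ≠ 0 := by
      intro z hz
      have h1 := Complex.norm_log_one_add_half_le_self hz
      rw [add_sub_cancel] at h1
      refine ⟨((Complex.abs_im_le_norm _).trans h1).trans (by linarith), ?_⟩
      rintro rfl
      norm_num at hz
    have hqM : ∀ j ≤ 2 * M, ‖pt δ (v j) / γ (s (j / 2)) - 1‖ ≤ 1 / 2 := by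
      intro j hj
      rcases hj.lt_or_eq with h | h
      · exact hq1 (j / 2) (by omega) j (by omega)
      · have e : 2 * M / 2 = M := by omega
        have := hq1 0 (by omega) 0 (by omega)
        rw [h, hvN, e, hsM, ← hγ01]
        rwa [hs0] at this
    set A : ℕ → ℂ := fun j => g (s (j / 2)) + Complex.log (pt δ (v j) / γ (s (j / 2))) with hA
    have hAexp : ∀ j ≤ 2 * M, Complex.exp (A j) = pt δ (v j) := by
      intro j hj
      have hmem := hsm (j / 2) (by omega)
      have hne := hγ0 _ hmem
      rw [hA, Complex.exp_add, Complex.exp_log (hlog _ (hqM j hj)).2, ← hge _ hmem]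
      field_simp
    have hAim : ∀ j < 2 * M, |(A (j + 1) - A j).im| ≤ 5 / 2 := by
      intro j hj
      have h1 := abs_le.1 (hlog _ (hqM j hj.le)).1
      have h2 := abs_le.1 (hlog _ (hqM (j + 1) hj)).1
      have h3 : |(g (s ((j + 1) / 2)) - g (s (j / 2))).im| ≤ 1 := by
        rcases (by omega : (j + 1) / 2 = j / 2 ∨ (j + 1) / 2 = j / 2 + 1) with e | e
        · rw [e]; simp
        · rw [e]
          exact (Complex.abs_im_le_norm _).trans (hgd _ (by omega)).le
      rw [Complex.sub_im] at h3
      have h3 := abs_le.1 h3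
      simp only [hA, Complex.sub_im, Complex.add_im]
      rw [abs_le]
      constructor <;> linarith [h1.1, h1.2, h2.1, h2.2, h3.1, h3.2]
    have hterm : ∀ j ∈ Finset.range (2 * M),
        (pt δ (v (j + 1)) / pt δ (v j)).arg = (A (j + 1)).im - (A j).im := by
      intro j hj
      rw [Finset.mem_range] at hj
      have h1 := abs_le.1 (hAim j hj)
      rw [← hAexp j hj.le, ← hAexp (j + 1) hj, ← Complex.exp_sub, ← Complex.log_im,
        Complex.log_exp, Complex.sub_im]
      · linarith [h1.1, Real.pi_gt_three]
      · linarith [h1.2, Real.pi_gt_three]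
    rw [Finset.sum_congr rfl hterm, Finset.sum_range_sub (fun j => (A j).im)]
    have e : 2 * M / 2 = M := by omega
    have h1 := congrArg Complex.im hg
    simp only [hA, e, hvN, hsM, ← hγ01, Nat.zero_div, hs0, Complex.add_im]
    simp at h1
    linarith

/-- A compact free set has a free neighbourhood. -/
lemma free_nhd (h : ℂ ≃ₜ ℂ) (K : Set ℂ) (hK : IsCompact K) (hf : ∀ x ∈ K, ∀ y ∈ K, h x ≠ y) :
    ∃ ε > 0, ∀ x ∈ Metric.thickening ε K, ∀ y ∈ Metric.thickening ε K, h x ≠ y := by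
  have hdisj : Disjoint (h '' K) K := by
    rw [Set.disjoint_left]
    rintro _ ⟨x, hx, rfl⟩ hy
    exact hf x hx _ hy rfl
  obtain ⟨η, hη, hd⟩ := hdisj.exists_thickenings (hK.image h.continuous) hK.isClosed
  obtain ⟨ε, hε, hs⟩ := hK.exists_thickening_subset_open
    (t := h ⁻¹' Metric.thickening η (h '' K) ∩ Metric.thickening η K)
    ((Metric.isOpen_thickening.preimage h.continuous).inter Metric.isOpen_thickening)
    (fun x hx => ⟨Metric.self_subset_thickening hη _ (mem_image_of_mem _ hx),
      Metric.self_subset_thickening hη _ hx⟩)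
  refine ⟨ε, hε, fun x hx y hy he => ?_⟩
  have h1 := (hs hx).1
  have h2 := (hs hy).2
  rw [mem_preimage, he] at h1
  exact Set.disjoint_left.1 hd h1 h2

lemma unif_eps (P : ℕ → ℝ → Prop) (hmono : ∀ i a b, 0 < a → a ≤ b → P i b → P i a) (l : ℕ)
    (hP : ∀ i < l, ∃ ε > 0, P i ε) : ∃ ε > 0, ∀ i < l, P i ε := by
  induction l with
  | zero => exact ⟨1, one_pos, by simp⟩
  | succ l ih =>
    obtain ⟨a, ha, h1⟩ := ih fun i hi => hP i (by omega)
    obtain ⟨b, hb, h2⟩ := hP l (by omega)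
    refine ⟨min a b, lt_min ha hb, fun i hi => ?_⟩
    rcases Nat.lt_succ_iff_lt_or_eq.1 hi with h | rfl
    · exact hmono _ _ _ (lt_min ha hb) (min_le_left _ _) (h1 i h)
    · exact hmono _ _ _ (lt_min ha hb) (min_le_right _ _) h2

/-- Every closed curve of degree one can be replaced by a Jordan curve of degree one with the
same number of free subarcs. -/
lemma jordan_of_loop (h : ℂ ≃ₜ ℂ) (hfix : ∀ x : ℂ, h x = x ↔ x = 0) (γ : ℝ → ℂ) (l : ℕ)
    (hγ : IsLoopIn γ) (hd : HasDeg γ 1) (hdec : Decomp (⇑h) γ l) :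
    ∃ c : ℝ → ℂ, IsLoopIn c ∧ HasDeg c 1 ∧ InjOn c (Ico 0 1) ∧ Decomp (⇑h) c l := by
  obtain ⟨t, t0, tl, tm, hfree⟩ := hdec
  have hlow : ∀ i ≤ l, 0 ≤ t i := by
    intro i hi
    induction i with
    | zero => exact t0.ge
    | succ i ih => exact (ih (by omega)).trans (tm i (by omega))
  have hup : ∀ k ≤ l, t (l - k) ≤ 1 := by
    intro k hk
    induction k with
    | zero => simpa using tl.le
    | succ k ih =>
      have := tm (l - (k + 1)) (by omega)
      rw [show l - (k + 1) + 1 = l - k by omega] at this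
      exact this.trans (ih (by omega))
  have hup' : ∀ i ≤ l, t i ≤ 1 := by
    intro i hi
    have := hup (l - i) (by omega)
    rwa [show l - (l - i) = i by omega] at this
  obtain ⟨ε, hε, hU⟩ := unif_eps (fun i ε =>
      ∀ x ∈ Metric.thickening ε (γ '' Icc (t i) (t (i + 1))),
      ∀ y ∈ Metric.thickening ε (γ '' Icc (t i) (t (i + 1))), h x ≠ y)
    (fun i a b _ hab hP x hx y hy => hP x (Metric.thickening_mono hab _ hx) y
      (Metric.thickening_mono hab _ hy)) l (by
      intro i hi
      apply free_nhd
      · exact isCompact_Icc.image_of_continuousOn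
          (hγ.1.mono (Icc_subset_Icc (hlow i hi.le) (hup' (i + 1) hi)))
      · rintro _ ⟨s, hs, rfl⟩ _ ⟨s', hs', rfl⟩
        exact hfree i hi s hs s' hs')
  obtain ⟨δ, hδ, N₀, v₀, p₀, hw₀, hsum₀⟩ := initial_walk γ hγ hd l t t0 tl ε hε
  obtain ⟨N, v, p, ⟨hc, hE, hp⟩, hpos, hinj⟩ := loop_erase _
    (fun z w => (pt δ w / pt δ z).arg) N₀ v₀ p₀ hw₀ (by
      rw [hsum₀]; linarith [Real.pi_pos])
  have hseg : ∀ j < N, ∀ u ∈ Icc (0:ℝ) 1,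
      pt δ (v j) + u * (pt δ (v (j + 1)) - pt δ (v j)) ≠ 0 := by
    intro j hj u hu h0
    have h1 := (hE j hj).2.2 u hu
    rw [h0] at h1
    exact hU _ (hE j hj).2.1 0 h1 0 h1 ((hfix 0).2 rfl)
  have hN : 3 ≤ N := by
    by_contra! hlt
    have hv0 : 0 < N → pt δ (v 0) ≠ 0 := fun h0 => by
      simpa using hseg 0 h0 0 ⟨le_rfl, zero_le_one⟩
    interval_cases N
    · simp at hpos
    · rw [Finset.sum_range_one, zero_add, hc, div_self (hv0 one_pos)] at hpos
      simp at hpos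
    · simp only [Finset.sum_range_succ, Finset.sum_range_zero, zero_add, one_add_one_eq_two,
        hc] at hpos
      have h1 := slit_of_seg _ _ (hseg 0 (by norm_num)) 1 ⟨zero_le_one, le_rfl⟩
      simp only [zero_add, Complex.ofReal_one, one_mul, add_sub_cancel] at h1
      have h2 : pt δ (v 0) / pt δ (v 1) = (pt δ (v 1) / pt δ (v 0))⁻¹ := by rw [inv_div]
      rw [h2, Complex.arg_inv, if_neg (Complex.slitPlane_arg_ne_pi h1)] at hpos
      linarith
  set V : ℕ → ℂ := fun j => pt δ (v j) with hV
  have hVc : V N = V 0 := by simp only [hV, hc]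
  obtain ⟨n, hn, hns⟩ := pl_hasDeg N (by omega) V hVc hseg
  have hI := grid_inj δ hδ N hN v hc (fun j hj => (hE j hj).1) hinj
  have hn1 : n ≤ 1 := deg_le_one _ n hn hI
  have hn0 : 0 < n := by
    have h1 : 0 < 2 * Real.pi * n := hns ▸ hpos
    have h2 : (0:ℝ) < n := by
      by_contra! hc
      nlinarith [Real.pi_pos]
    exact_mod_cast h2
  have hn' : n = 1 := by omega
  subst hn'
  have hNR : (0:ℝ) < N := by exact_mod_cast (by omega : 0 < N)
  refine ⟨fun t => pl N V (N * t), ⟨?_, ?_, ?_⟩, hn, hI, ?_⟩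
  · have := pl_cont N V
    exact Continuous.continuousOn (by fun_prop)
  · obtain ⟨M, rfl⟩ : ∃ M, N = M + 1 := ⟨N - 1, by omega⟩
    have e0 := pl_eval (M + 1) V 0 (by omega) 0 ⟨le_rfl, zero_le_one⟩
    have e1 := pl_eval (M + 1) V M (by omega) 1 ⟨zero_le_one, le_rfl⟩
    simp at e0
    simp [hVc] at e1
    simp [e0, e1]
  · intro t ht h0
    obtain ⟨g, _, hg, _⟩ := hn
    rw [hg t ht] at h0
    exact Complex.exp_ne_zero _ h0
  · exact walk_decomp h (fun i => Metric.thickening ε (γ '' Icc (t i) (t (i + 1)))) l N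
      (by omega) V p hU hp (fun j hj => (hE j hj).2.1) (fun j hj => (hE j hj).2.2)

/-- Every closed curve has a finite decomposition. -/
lemma exists_decomp (h : ℂ ≃ₜ ℂ) (hfix : ∀ x : ℂ, h x = x ↔ x = 0) (γ : ℝ → ℂ)
    (hγ : IsLoopIn γ) : ∃ l : ℕ, Decomp (⇑h) γ l := by
  obtain ⟨hγc, _, hγ0⟩ := hγ
  obtain ⟨m, hm, hmb⟩ : ∃ m > 0, ∀ s ∈ Icc (0:ℝ) 1, m ≤ ‖h (γ s) - γ s‖ := by
    obtain ⟨s, hs, hmin⟩ := isCompact_Icc.exists_isMinOn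
      (nonempty_Icc.2 (zero_le_one (α := ℝ)))
      ((h.continuous.comp_continuousOn hγc).sub hγc).norm
    refine ⟨‖h (γ s) - γ s‖, norm_pos_iff.2 fun h0 => ?_, fun s' hs' => hmin hs'⟩
    exact hγ0 s hs ((hfix _).1 (sub_eq_zero.1 h0))
  obtain ⟨θ, hθ, hu⟩ := unif_sub γ hγc m hm
  obtain ⟨M₀, hM₀⟩ := exists_nat_gt (1 / θ)
  set M := M₀ + 1 with hMdef
  have hM : (0:ℝ) < M := by positivity
  have hMθ : 1 / (M:ℝ) < θ := by
    rw [div_lt_comm₀ hM hθ]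
    refine hM₀.trans ?_
    rw [hMdef]; push_cast; linarith
  refine ⟨M, fun i => i / M, by simp, div_self hM.ne', ?_, ?_⟩
  · intro i _
    exact div_le_div_of_nonneg_right (by push_cast; linarith) hM.le
  · intro i hi s hs s' hs' he
    have hlo : (0:ℝ) ≤ i / M := by positivity
    have hhi : ((i + 1 : ℕ) : ℝ) / M ≤ 1 := by
      rw [div_le_one hM]; exact_mod_cast hi
    have hgap : ((i + 1 : ℕ) : ℝ) / M = i / M + 1 / M := by push_cast; ring
    have hs1 : s ∈ Icc (0:ℝ) 1 := ⟨hlo.trans hs.1, hs.2.trans hhi⟩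
    have hs1' : s' ∈ Icc (0:ℝ) 1 := ⟨hlo.trans hs'.1, hs'.2.trans hhi⟩
    have h1 := hu s' hs1' s hs1 (by
      have a1 := hs.1
      have a2 := hs.2
      have b1 := hs'.1
      have b2 := hs'.2
      dsimp only at a1 a2 b1 b2
      rw [hgap] at a2 b2
      rw [abs_lt]
      constructor <;> linarith)
    have h2 := hmb s hs1
    rw [he] at h2
    linarith

lemma circle_loop : IsLoopIn (circleLoop 1) ∧ HasDeg (circleLoop 1) 1 := by
  refine ⟨⟨?_, ?_, ?_⟩, fun t => ((2 * Real.pi * t : ℝ) : ℂ) * Complex.I, ?_, ?_, ?_⟩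
  · unfold circleLoop
    exact Continuous.continuousOn (by fun_prop)
  · simp [circleLoop]
  · intro t _
    simp [circleLoop]
  · exact Continuous.continuousOn (by fun_prop)
  · intro t _
    simp [circleLoop]
  · simp

/-- For an orientation-preserving homeomorphism of the plane fixing only `0` with
fixed-point index different from `1`: every closed curve of degree `1` around `0`
admits a finite decomposition into `h`-free arcs, and there is a Jordan curve of
degree `1` realizing the minimal `h`-length among all degree-1 closed curves. -/
theorem stmt12 (h : ℂ ≃ₜ ℂ) (hor : IsotopicToId ⇑h)
    (hfix : ∀ x : ℂ, h x = x ↔ x = 0)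
    (ι : ℤ) (hι : HasIndex ⇑h ι) (hι1 : ι ≠ 1) :
    (∀ γ : ℝ → ℂ, IsLoopIn γ → HasDeg γ 1 → ∃ l : ℕ, Decomp (⇑h) γ l) ∧
    (∃ (γ : ℝ → ℂ) (l : ℕ), IsLoopIn γ ∧ HasDeg γ 1 ∧ InjOn γ (Ico 0 1) ∧
      Decomp (⇑h) γ l ∧
      ∀ (γ' : ℝ → ℂ) (l' : ℕ), IsLoopIn γ' → HasDeg γ' 1 → Decomp (⇑h) γ' l' →
        l ≤ l') := by
  classical
  refine ⟨fun γ hγ _ => exists_decomp h hfix γ hγ, ?_⟩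
  have hex : ∃ l : ℕ, ∃ γ : ℝ → ℂ, IsLoopIn γ ∧ HasDeg γ 1 ∧ Decomp (⇑h) γ l := by
    obtain ⟨l, hl⟩ := exists_decomp h hfix _ circle_loop.1
    exact ⟨l, _, circle_loop.1, circle_loop.2, hl⟩
  obtain ⟨γ₀, h1, h2, h3⟩ := Nat.find_spec hex
  obtain ⟨c, hc1, hc2, hc3, hc4⟩ := jordan_of_loop h hfix γ₀ _ h1 h2 h3
  exact ⟨c, Nat.find hex, hc1, hc2, hc3, hc4, fun γ' l' g1 g2 g3 =>
    Nat.find_min' hex ⟨γ', g1, g2, g3⟩⟩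
end

section
/- There is no Jordan curve in ℝ² ∖ {0} whose winding number around 0 has absolute value strictly greater than 1. -/
open Set

/-- A continuous function with constant exponential on a preconnected set is constant. -/
theorem const_of_exp_const {S : Set ℝ} (hS : IsPreconnected S) {φ : ℝ → ℂ}
    (hφ : ContinuousOn φ S) (he : ∀ a ∈ S, Complex.exp (φ a) = 1) {a b : ℝ}
    (ha : a ∈ S) (hb : b ∈ S) : φ a = φ b :=
  Complex.isCoveringMap_exp.constOn_of_comp hS hφ
    (fun x hx y hy => Subtype.ext (by simp [he x hx, he y hy])) ha hb

/-- If `exp h = F` and `c * F` stays in the slit plane, the variation of `h` is that of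
the principal logarithm of `c * F`. -/
theorem variation_log {S : Set ℝ} (hS : IsPreconnected S) {h F : ℝ → ℂ} (c : ℂ) (hc : c ≠ 0)
    (hh : ContinuousOn h S) (hF : ContinuousOn F S) (he : ∀ a ∈ S, Complex.exp (h a) = F a)
    (hs : ∀ a ∈ S, c * F a ∈ Complex.slitPlane) {a b : ℝ}
    (ha : a ∈ S) (hb : b ∈ S) :
    h a - h b = Complex.log (c * F a) - Complex.log (c * F b) := by
  have := const_of_exp_const (φ := fun x => h x + Complex.log c - Complex.log (c * F x)) hS
    ((hh.add continuousOn_const).sub ((continuousOn_const.mul hF).clog hs)) (fun x hx => by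
      have hne : c * F x ≠ 0 := Complex.slitPlane_ne_zero (hs x hx)
      rw [Complex.exp_sub, Complex.exp_add, Complex.exp_log hc, Complex.exp_log hne, he x hx,
        mul_comm, div_self hne]) ha hb
  linear_combination this

theorem log_neg_of_im_pos {z : ℂ} (hz : 0 < z.im) :
    Complex.log (-z) = Complex.log z - Real.pi * Complex.I := by
  simp only [Complex.log, norm_neg, Complex.arg_neg_eq_arg_sub_pi_of_im_pos hz]
  push_cast; ring

theorem log_neg_of_im_neg {z : ℂ} (hz : z.im < 0) :
    Complex.log (-z) = Complex.log z + Real.pi * Complex.I := by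
  simp only [Complex.log, norm_neg, Complex.arg_neg_eq_arg_add_pi_of_im_neg hz]
  push_cast; ring

theorem core (G : ℝ → ℂ) (hG : Continuous G) (n : ℤ) (hn : n ≠ 0)
    (hper : ∀ (s : ℝ) (m : ℤ), G (s + m) = G s + (m * n : ℂ) * (2 * Real.pi * Complex.I))
    (hne : ∀ s t, G s - G t ≠ 2 * Real.pi * Complex.I) : False := by
  have hpi := Real.pi_gt_three
  have hre : ∀ s, (G s).re = (G (Int.fract s)).re := by
    intro s
    have h1 := hper (Int.fract s) ⌊s⌋
    rw [Int.fract_add_floor] at h1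
    rw [h1]
    simp
  have hfr : ∀ s : ℝ, Int.fract s ∈ Icc (0:ℝ) 1 :=
    fun s => ⟨Int.fract_nonneg s, (Int.fract_lt_one s).le⟩
  have hGre : Continuous fun s => (G s).re := Complex.continuous_re.comp hG
  obtain ⟨t0, ht0, hmax⟩ := isCompact_Icc.exists_isMaxOn (s := Icc (0:ℝ) 1)
    ⟨0, by simp⟩ hGre.continuousOn
  obtain ⟨t1, ht1, hmin⟩ := isCompact_Icc.exists_isMinOn (s := Icc (0:ℝ) 1)
    ⟨0, by simp⟩ hGre.continuousOn
  have hmax' : ∀ s, (G s).re ≤ (G t0).re := fun s => by rw [hre s]; exact hmax (hfr s)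
  have hmin' : ∀ s, (G t1).re ≤ (G s).re := fun s => by rw [hre s]; exact hmin (hfr s)
  obtain ⟨K, hK⟩ := isCompact_Icc.exists_bound_of_continuousOn (s := Icc (0:ℝ) 1)
    (f := fun t => (G 0 - G t).im) (by fun_prop)
  have hK0 : 0 ≤ K := (norm_nonneg _).trans (hK 0 (by simp))
  obtain ⟨M, hM⟩ := exists_nat_gt (K + 1)
  have hn2 : (1:ℝ) ≤ (n:ℝ) * n := by
    have : (1:ℤ) ≤ n * n := by
      have := mul_self_pos.2 hn
      omega
    exact_mod_cast this
  set N : ℤ := n * M with hN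
  have hNn : (M:ℝ) ≤ (N:ℝ) * n := by
    rw [hN]; push_cast
    nlinarith
  let F : C(ℝ × ℝ, ℂ) := ⟨fun p => G p.1 - G p.2 - 2 * Real.pi * Complex.I, by fun_prop⟩
  have hF : ∀ p, F p = G p.1 - G p.2 - 2 * Real.pi * Complex.I := fun p => rfl
  have hF0 : ∀ p, F p ≠ 0 := fun p => sub_ne_zero.2 (hne p.1 p.2)
  obtain ⟨h, ⟨-, hh⟩, -⟩ := Complex.isCoveringMapOn_exp.existsUnique_continuousMap_lifts F
    (a₀ := (0, 0)) (e₀ := Complex.log (F (0, 0))) (Complex.exp_log (hF0 _)) (fun a => hF0 a)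
  have he : ∀ p, Complex.exp (h p) = F p := fun p => congrFun hh p
  have him : ∀ (m : ℤ) (t : ℝ), (F (m, t)).im = (G 0 - G t).im + 2 * Real.pi * (m * n - 1) := by
    intro m t
    have h1 := hper 0 m
    rw [zero_add] at h1
    simp only [hF, h1]
    simp
    ring
  have hpos : ∀ t ∈ Icc (0:ℝ) 1, 0 < (F ((N : ℝ), t)).im := by
    intro t ht
    have h1 := (abs_le.1 (hK t ht)).1
    rw [him]
    nlinarith
  have hneg : ∀ t ∈ Icc (0:ℝ) 1, (F (((-N : ℤ) : ℝ), t)).im < 0 := by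
    intro t ht
    have h1 := (abs_le.1 (hK t ht)).2
    rw [him]
    push_cast
    nlinarith
  have e1 := variation_log (S := Icc 0 1) isPreconnected_Icc (h := fun t => h ((N : ℝ), t))
    (F := fun t => F ((N : ℝ), t)) 1 one_ne_zero (by fun_prop) (by fun_prop)
    (fun t _ => he _) (fun t ht => by
      rw [one_mul]; exact Or.inr (hpos t ht).ne') ht0 ht1
  have e2 := variation_log (S := Icc 0 1) isPreconnected_Icc
    (h := fun t => h (((-N : ℤ) : ℝ), t))
    (F := fun t => F (((-N : ℤ) : ℝ), t)) 1 one_ne_zero (by fun_prop) (by fun_prop)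
    (fun t _ => he _) (fun t ht => by
      rw [one_mul]; exact Or.inr (hneg t ht).ne) ht0 ht1
  have e3 := variation_log (S := univ) isPreconnected_univ (h := fun s => h (s, t1))
    (F := fun s => F (s, t1)) 1 one_ne_zero (by fun_prop) (by fun_prop)
    (fun t _ => he _) (fun s _ => by
      rw [one_mul, Complex.mem_slitPlane_iff]
      by_contra! hcon
      refine hF0 (s, t1) (Complex.ext (le_antisymm hcon.1 ?_) hcon.2)
      have := hmin' s
      simp [hF]; linarith) (mem_univ (N : ℝ)) (mem_univ ((-N : ℤ) : ℝ))
  have e4 := variation_log (S := univ) isPreconnected_univ (h := fun s => h (s, t0))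
    (F := fun s => F (s, t0)) (-1) (by simp) (by fun_prop) (by fun_prop)
    (fun t _ => he _) (fun s _ => by
      rw [neg_one_mul, Complex.mem_slitPlane_iff]
      by_contra! hcon
      simp only [Complex.neg_re, Complex.neg_im, neg_nonpos, neg_eq_zero] at hcon
      refine hF0 (s, t0) (Complex.ext (le_antisymm ?_ hcon.1) hcon.2)
      have := hmax' s
      simp [hF]; linarith) (mem_univ (N : ℝ)) (mem_univ ((-N : ℤ) : ℝ))
  simp only [one_mul, neg_one_mul] at e1 e2 e3 e4
  rw [log_neg_of_im_pos (hpos t0 ht0), log_neg_of_im_neg (hneg t0 ht0)] at e4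
  have : (2:ℂ) * Real.pi * Complex.I = 0 := by
    linear_combination e4 - e1 + e2 - e3
  simp [Real.pi_ne_zero] at this

/-- There is no Jordan curve in `ℝ² ∖ {0}` whose winding number around `0` has absolute
value strictly greater than `1`. -/
theorem stmt14 (γ : ℝ → ℂ) (n : ℤ)
    (hc : ContinuousOn γ (Icc 0 1)) (hclosed : γ 0 = γ 1)
    (h0 : ∀ t ∈ Icc (0:ℝ) 1, γ t ≠ 0)
    (hinj : InjOn γ (Ico 0 1))
    (hdeg : HasDeg γ n) :
    |n| ≤ 1 := by
  obtain ⟨g, hg, hexp, hend⟩ := hdeg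
  by_contra hcon
  have hn : n ≠ 0 := by rintro rfl; simp at hcon
  have h2pi : (2 * Real.pi * Complex.I : ℂ) ≠ 0 := by simp [Real.pi_ne_zero]
  let f : ℝ → ℂ := fun t => g t - (t * n : ℂ) * (2 * Real.pi * Complex.I)
  have hf : ContinuousOn f (Icc 0 1) := hg.sub (by fun_prop)
  have hf01 : f 0 = f 1 := by
    push_cast at hend
    simp only [f]
    push_cast
    linear_combination -hend
  let G : ℝ → ℂ := fun s => (f ∘ Int.fract) s + (s * n : ℂ) * (2 * Real.pi * Complex.I)
  have hG : Continuous G := (hf.comp_fract'' hf01).add (by fun_prop)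
  have hGexp : ∀ s, Complex.exp (G s) = γ (Int.fract s) := by
    intro s
    have hm : Int.fract s ∈ Icc (0:ℝ) 1 := ⟨Int.fract_nonneg s, (Int.fract_lt_one s).le⟩
    rw [hexp _ hm, Complex.exp_eq_exp_iff_exists_int]
    refine ⟨⌊s⌋ * n, ?_⟩
    have : (s:ℂ) = ((Int.fract s : ℝ) : ℂ) + (⌊s⌋ : ℂ) := by
      exact_mod_cast congrArg (fun x : ℝ => (x : ℂ)) (Int.fract_add_floor s).symm
    simp only [G, f, Function.comp]
    push_cast
    linear_combination (n * (2 * Real.pi * Complex.I) : ℂ) * this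
  refine core G hG n hn ?_ ?_
  · intro s m
    simp only [G, Function.comp, Int.fract_add_intCast]
    push_cast
    ring
  · intro s t hst
    have h1 : γ (Int.fract s) = γ (Int.fract t) := by
      rw [← hGexp, ← hGexp, Complex.exp_eq_exp_iff_exists_int]
      exact ⟨1, by push_cast; linear_combination hst⟩
    have h2 := hinj ⟨Int.fract_nonneg s, Int.fract_lt_one s⟩
      ⟨Int.fract_nonneg t, Int.fract_lt_one t⟩ h1
    obtain ⟨m, hm⟩ := Int.fract_eq_fract.1 h2
    have hm' : (s:ℂ) - t = m := by exact_mod_cast congrArg (fun x : ℝ => (x : ℂ)) hm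
    simp only [G, Function.comp, h2] at hst
    have h3 : (m * n : ℂ) = 1 := by
      apply mul_right_cancel₀ h2pi
      linear_combination hst - (n * (2 * Real.pi * Complex.I) : ℂ) * hm'
    have h4 : m * n = 1 := by exact_mod_cast h3
    apply hcon
    rcases Int.eq_one_or_neg_one_of_mul_eq_one (show n * m = 1 by rw [mul_comm]; exact h4)
      with h | h <;> simp [h]
end
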